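/- arXiv:0804.1316 — 2 statements merged into one kernel-verified Lean document; each statement's English description precedes it below -/
import Mathlib

section
/- Let P⁺ ⊂ Sym²(ℝⁿ) be a closed convex cone containing the cone P of positive semidefinite matrices, with polar cone P₊ = {A : ⟨A,B⟩ ≥ 0 for all B ∈ P⁺} (inner product ⟨A,B⟩ = tr(AB)). Then for B ∈ Sym²(ℝⁿ): B ∉ −Int(P⁺) if and only if for every A ∈ P⁺, A + B ∉ −Int(P), where Int(P) is the set of positive definite matrices. -/
open Matrix

lemma posDef_nhds (n : ℕ) (D : Matrix (Fin n) (Fin n) ℝ) (hD : D.PosDef) :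
    ∀ᶠ X in nhds D, X.IsSymm → X.PosSemidef := by
  have key : ∀ᶠ X in nhds D, ∀ x ∈ Metric.sphere (0 : Fin n → ℝ) 1, 0 < x ⬝ᵥ (X *ᵥ x) := by
    apply (isCompact_sphere (0 : Fin n → ℝ) 1).eventually_forall_of_forall_eventually
    intro x hx
    have hx0 : x ≠ 0 := by
      rintro rfl
      simp at hx
    have hc : Continuous fun z : Matrix (Fin n) (Fin n) ℝ × (Fin n → ℝ) =>
        z.2 ⬝ᵥ (z.1 *ᵥ z.2) := by fun_prop
    have hpos : 0 < x ⬝ᵥ (D *ᵥ x) := by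
      simpa using hD.dotProduct_mulVec_pos hx0
    exact hc.continuousAt.eventually (lt_mem_nhds hpos)
  filter_upwards [key] with X hX hs
  refine Matrix.PosSemidef.of_dotProduct_mulVec_nonneg ?_ ?_
  · simpa [Matrix.IsHermitian, Matrix.conjTranspose_eq_transpose_of_trivial] using hs.eq
  · intro x
    by_cases hx : x = 0
    · simp [hx]
    have hn : 0 < ‖x‖ := norm_pos_iff.mpr hx
    have h := hX (‖x‖⁻¹ • x) (by simp [norm_smul, hn.ne'])
    rw [Matrix.mulVec_smul, smul_dotProduct, dotProduct_smul, smul_eq_mul, smul_eq_mul] at h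
    have hi : 0 < ‖x‖⁻¹ := inv_pos.mpr hn
    have := (pos_iff_pos_of_mul_pos h).mp hi
    have := (pos_iff_pos_of_mul_pos this).mp hi
    simpa using this.le


/-- If `P⁺ ⊂ Sym²(ℝⁿ)` is a closed convex cone containing the positive
semidefinite cone `P`, with polar cone `P₊`, then for a symmetric matrix `B`:
`B ∉ −Int(P⁺)` iff for every `A ∈ P⁺`, `A + B ∉ −Int(P)` (i.e. `−(A+B)` is not
positive definite).  `Int` is the interior relative to the span (the symmetric matrices),
i.e. the intrinsic interior. -/
theorem stmt1 (n : ℕ) (Pup : Set (Matrix (Fin n) (Fin n) ℝ))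
    (hsym : ∀ A ∈ Pup, A.IsSymm)
    (hclosed : IsClosed Pup) (hconv : Convex ℝ Pup)
    (hcone : ∀ c : ℝ, 0 ≤ c → ∀ A ∈ Pup, c • A ∈ Pup)
    (hP : ∀ A : Matrix (Fin n) (Fin n) ℝ, A.PosSemidef → A ∈ Pup)
    (Plow : Set (Matrix (Fin n) (Fin n) ℝ))
    (hPlow : Plow = {A | A.IsSymm ∧ ∀ B ∈ Pup, 0 ≤ (A * B).trace})
    (B : Matrix (Fin n) (Fin n) ℝ) (hB : B.IsSymm) :
    (-B ∉ intrinsicInterior ℝ Pup) ↔ ∀ A ∈ Pup, ¬ (-(A + B)).PosDef := by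
  have h0 : (0 : Matrix (Fin n) (Fin n) ℝ) ∈ Pup := hP _ Matrix.PosSemidef.zero
  have h1 : (1 : Matrix (Fin n) (Fin n) ℝ) ∈ Pup := hP _ Matrix.PosSemidef.one
  have hadd : ∀ X ∈ Pup, ∀ Y ∈ Pup, X + Y ∈ Pup := by
    intro X hX Y hY
    have h := hconv (hcone 2 (by norm_num) X hX) (hcone 2 (by norm_num) Y hY)
      (show (0 : ℝ) ≤ 1 / 2 by norm_num) (show (0 : ℝ) ≤ 1 / 2 by norm_num) (by norm_num)
    simpa [smul_smul] using h
  rw [← not_iff_not]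
  push Not
  rw [mem_intrinsicInterior]
  constructor
  · rintro ⟨y, hy, hyB⟩
    have hmem : ∀ t : ℝ, (y : Matrix (Fin n) (Fin n) ℝ) - t • 1 ∈ affineSpan ℝ Pup := by
      intro t
      have := AffineSubspace.smul_vsub_vadd_mem (affineSpan ℝ Pup) t
        (subset_affineSpan ℝ Pup h0) (subset_affineSpan ℝ Pup h1) y.2
      convert this using 1
      simp [sub_eq_neg_add]
    let g : ℝ → affineSpan ℝ Pup := fun t => ⟨(y : Matrix (Fin n) (Fin n) ℝ) - t • 1, hmem t⟩
    have hg : Continuous g := by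
      apply Continuous.subtype_mk
      fun_prop
    have hg0 : g 0 = y := by
      apply Subtype.ext
      simp [g]
    have hev : ∀ᶠ t in nhds (0 : ℝ), g t ∈ ((↑) ⁻¹' Pup : Set (affineSpan ℝ Pup)) := by
      apply hg.continuousAt.eventually
      rw [hg0]
      exact mem_interior_iff_mem_nhds.mp hy
    have hev' := (hev.filter_mono nhdsWithin_le_nhds).and
      (self_mem_nhdsWithin : Set.Ioi (0 : ℝ) ∈ nhdsWithin 0 (Set.Ioi 0))
    obtain ⟨t, ht, htpos⟩ := hev'.exists
    refine ⟨_, ht, ?_⟩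
    have : -(((g t : affineSpan ℝ Pup) : Matrix (Fin n) (Fin n) ℝ) + B) = t • 1 := by
      simp [g, hyB]
    rw [this]
    exact Matrix.PosDef.one.smul htpos
  · rintro ⟨A, hA, hpd⟩
    have hC : -B ∈ Pup := by
      have := hadd _ hA _ (hP _ hpd.posSemidef)
      simpa using this
    refine ⟨⟨-B, subset_affineSpan ℝ Pup hC⟩, ?_, rfl⟩
    rw [mem_interior_iff_mem_nhds]
    have hc : Continuous fun X : affineSpan ℝ Pup => (X : Matrix (Fin n) (Fin n) ℝ) - A := by
      fun_prop
    have hev := (hc.tendsto' ⟨-B, subset_affineSpan ℝ Pup hC⟩ (-(A + B))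
      (by simp [sub_eq_add_neg])).eventually (posDef_nhds n _ hpd)
    filter_upwards [hev] with X hX
    have hXs : (X : Matrix (Fin n) (Fin n) ℝ).IsSymm := by
      refine affineSpan_induction (p := fun X : Matrix (Fin n) (Fin n) ℝ => X.IsSymm)
        X.2 hsym ?_
      intro c u v w hu hv hw
      simp only [vsub_eq_sub, vadd_eq_add]
      exact ((hu.sub hv).smul c).add hw
    have := hadd _ hA _ (hP _ (hX (hXs.sub (hsym A hA))))
    simpa using this
end

section
/- For 1 ≤ k ≤ n, let P⁺(σ_k) ⊂ Sym²(ℝⁿ) be the closure of the connected component containing the identity of {A : σ_k(A) > 0}, where σ_k is the k-th elementary symmetric function of the eigenvalues. Then every k-dimensional subspace N ⊂ ℝⁿ satisfies σ_k(P_N) = 1 (so P_N ∈ Int P⁺(σ_k)), while σ_k(P_N') = 0 for every subspace N' of dimension k−1. Consequently the free dimension of the polar cone P₊(σ_k) is n−k. -/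
open Matrix

namespace Stmt15
open Polynomial

lemma splits_derivative {p : ℝ[X]} (hp : p.Splits) : (derivative p).Splits := by
  rw [splits_iff_card_roots] at hp ⊢
  have h1 := card_roots_le_derivative p
  have h2 := card_roots' (derivative p)
  have h3 := natDegree_derivative_le p
  omega

lemma splits_iter {p : ℝ[X]} (hp : p.Splits) (m : ℕ) : (derivative^[m] p).Splits := by
  induction m with
  | zero => simpa using hp
  | succ m ih => rw [Function.iterate_succ_apply']; exact splits_derivative ih

/-- Laguerre inequality for a product of linear factors. -/
lemma laguerre_prod (c x : ℝ) (s : Multiset ℝ) :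
    let p : ℝ[X] := C c * (s.map fun a => X - C a).prod
    0 ≤ (derivative p).eval x ^ 2 - p.eval x * (derivative (derivative p)).eval x ∧
    (p.eval x ≠ 0 → s ≠ 0 →
      0 < (derivative p).eval x ^ 2 - p.eval x * (derivative (derivative p)).eval x) := by
  induction s using Multiset.induction with
  | empty => simp
  | cons a s ih =>
    intro p
    set u : ℝ[X] := C c * (s.map fun a => X - C a).prod with hu
    have hp : p = (X - C a) * u := by
      simp only [p, hu, Multiset.map_cons, Multiset.prod_cons]; ring
    have h := ih.1
    have key : (derivative p).eval x ^ 2 - p.eval x * (derivative (derivative p)).eval x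
        = u.eval x ^ 2 + (x - a) ^ 2 * ((derivative u).eval x ^ 2
          - u.eval x * (derivative (derivative u)).eval x) := by
      rw [hp]; simp; ring
    rw [key]
    have h2 := mul_nonneg (sq_nonneg (x - a)) h
    refine ⟨by positivity, fun h0 _ => ?_⟩
    have hu0 : u.eval x ≠ 0 := by
      intro h; apply h0; rw [hp]; simp [h]
    have : 0 < u.eval x ^ 2 := by positivity
    linarith

lemma laguerre {p : ℝ[X]} (hp : p.Splits) (x : ℝ) :
    0 ≤ (derivative p).eval x ^ 2 - p.eval x * (derivative (derivative p)).eval x ∧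
    (p.eval x ≠ 0 → p.natDegree ≠ 0 →
      0 < (derivative p).eval x ^ 2 - p.eval x * (derivative (derivative p)).eval x) := by
  have h := laguerre_prod p.leadingCoeff x p.roots
  rw [← hp.eq_prod_roots] at h
  exact ⟨h.1, fun h0 h1 => h.2 h0 (hp.roots_ne_zero h1)⟩

/-- Newton's inequality (weak and strict). -/
lemma newton {p : ℝ[X]} (hp : p.Splits) (m : ℕ) :
    0 ≤ (m + 1) * p.coeff (m + 1) ^ 2 - (m + 2) * (p.coeff m * p.coeff (m + 2)) ∧
    (p.coeff m ≠ 0 → (∃ k, m < k ∧ p.coeff k ≠ 0) →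
    0 < (m + 1) * p.coeff (m + 1) ^ 2 - (m + 2) * (p.coeff m * p.coeff (m + 2))) := by
  have h := laguerre (splits_iter hp m) 0
  have e0 : (derivative^[m] p).eval 0 = m.factorial * p.coeff m := by
    rw [← coeff_zero_eq_eval_zero, coeff_iterate_derivative, zero_add,
      Nat.descFactorial_self, nsmul_eq_mul]
  have e1 : (derivative (derivative^[m] p)).eval 0 = (m + 1).factorial * p.coeff (m + 1) := by
    rw [← Function.iterate_succ_apply' derivative, ← coeff_zero_eq_eval_zero,
      coeff_iterate_derivative, zero_add, Nat.descFactorial_self, nsmul_eq_mul]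
  have e2 : (derivative (derivative (derivative^[m] p))).eval 0
      = (m + 2).factorial * p.coeff (m + 2) := by
    rw [← Function.iterate_succ_apply' derivative, ← Function.iterate_succ_apply' derivative,
      ← coeff_zero_eq_eval_zero, coeff_iterate_derivative, zero_add, Nat.descFactorial_self, nsmul_eq_mul]
  rw [e0, e1, e2] at h
  have hf : (0:ℝ) < m.factorial := by exact_mod_cast m.factorial_pos
  have key : (((m + 1).factorial : ℝ) * p.coeff (m + 1)) ^ 2
      - m.factorial * p.coeff m * ((m + 2).factorial * p.coeff (m + 2))
      = ((m.factorial : ℝ) ^ 2 * (m + 1)) *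
        ((m + 1) * p.coeff (m + 1) ^ 2 - (m + 2) * (p.coeff m * p.coeff (m + 2))) := by
    rw [Nat.factorial_succ (m + 1), Nat.factorial_succ m]; push_cast; ring
  rw [key] at h
  have hpos : (0:ℝ) < (m.factorial : ℝ) ^ 2 * (m + 1) := by positivity
  refine ⟨nonneg_of_mul_nonneg_right h.1 hpos, fun h0 ⟨k, hk, hk0⟩ => ?_⟩
  refine pos_of_mul_pos_right (h.2 (by positivity) ?_) hpos.le
  intro hd
  have : (derivative^[m] p).coeff (k - m) = 0 :=
    coeff_eq_zero_of_natDegree_lt (by omega)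
  rw [coeff_iterate_derivative, Nat.sub_add_cancel hk.le] at this
  rw [smul_eq_zero, Nat.descFactorial_eq_zero_iff_lt] at this
  rcases this with h | h
  · omega
  · exact hk0 h

noncomputable def R (s : Multiset ℝ) : ℝ[X] := (s.map fun a => 1 + C a * X).prod

lemma R_cons (a : ℝ) (s : Multiset ℝ) : R (a ::ₘ s) = (1 + C a * X) * R s := by simp [R]

lemma R_splits (s : Multiset ℝ) : (R s).Splits := by
  apply Splits.multisetProd
  intro f hf
  obtain ⟨a, -, rfl⟩ := Multiset.mem_map.1 hf
  apply Splits.of_natDegree_le_one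
  compute_degree

lemma R_zero (s : Multiset ℝ) : (R s).coeff 0 = 1 := by
  induction s using Multiset.induction with
  | empty => simp [R]
  | cons a s ih => rw [R_cons, mul_coeff_zero, ih]; simp

lemma R_cons_succ (a : ℝ) (s : Multiset ℝ) (j : ℕ) :
    (R (a ::ₘ s)).coeff (j + 1) = (R s).coeff (j + 1) + a * (R s).coeff j := by
  rw [R_cons, add_mul, one_mul, coeff_add, mul_assoc, coeff_C_mul, coeff_X_mul]

lemma R_one (s : Multiset ℝ) : (R s).coeff 1 = s.sum := by
  induction s using Multiset.induction with
  | empty => simp [R, coeff_one]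
  | cons a s ih => rw [R_cons_succ, ih, R_zero]; simp; ring

/-- closedness of the Garding cone inside `σ_k > 0`. -/
lemma pos_of_nonneg (s : Multiset ℝ) (k : ℕ) (h : ∀ j ≤ k, 0 ≤ (R s).coeff j)
    (hk : 0 < (R s).coeff k) : ∀ j ≤ k, 0 < (R s).coeff j := by
  intro j
  induction j with
  | zero => intro _; rw [R_zero]; norm_num
  | succ j ih =>
    intro hj
    rcases (h _ hj).lt_or_eq with h0 | h0
    · exact h0
    exfalso
    have hne : j + 1 ≠ k := by rintro rfl; linarith
    have hN := (newton (R_splits s) j).2 (ih (by omega)).ne' ⟨k, by omega, hk.ne'⟩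
    rw [← h0] at hN
    have := mul_nonneg (ih (by omega)).le (h (j + 2) (by omega))
    have : 0 ≤ ((j:ℝ) + 2) * ((R s).coeff j * (R s).coeff (j + 2)) := by positivity
    norm_num at hN
    linarith

lemma remove_one (a : ℝ) (s : Multiset ℝ) (k : ℕ)
    (h : ∀ j ≤ k + 1, 0 < (R (a ::ₘ s)).coeff j) : ∀ j ≤ k, 0 < (R s).coeff j := by
  intro j
  induction j with
  | zero => intro _; rw [R_zero]; norm_num
  | succ j ih =>
    intro hj
    have i0 := ih (by omega)
    have h1 := h (j + 1) (by omega)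
    have h2 := h (j + 2) (by omega)
    rw [R_cons_succ] at h1 h2
    by_contra hc
    push Not at hc
    have hN := (newton (R_splits s) j).1
    set x := (R s).coeff j
    set y := (R s).coeff (j + 1)
    set z := (R s).coeff (j + 2)
    have ha : 0 < a := by
      by_contra ha
      push Not at ha
      nlinarith
    have hz : 0 < z := by nlinarith
    have hxz : 0 < x * z := mul_pos i0 hz
    have hw : x * z ≤ y ^ 2 := by
      have : (j + 1) * (x * z) ≤ (j + 1 : ℝ) * y ^ 2 := by nlinarith
      exact le_of_mul_le_mul_left this (by positivity)
    nlinarith [mul_pos i0 h2, mul_nonneg (neg_nonneg.2 hc) h1.le]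

lemma remove_many (t s : Multiset ℝ) (k : ℕ)
    (h : ∀ j ≤ k + t.card, 0 < (R (t + s)).coeff j) : ∀ j ≤ k, 0 < (R s).coeff j := by
  induction t using Multiset.induction generalizing k with
  | empty => simpa using h
  | cons a t ih =>
    apply ih
    apply remove_one a
    rw [Multiset.cons_add] at h
    rw [Multiset.card_cons] at h
    exact h

lemma sum_pos_of_card {n : ℕ} (l : Fin n → ℝ) (k : ℕ) (hk1 : 1 ≤ k) (hkn : k ≤ n)
    (h : ∀ j ≤ k, 0 < (R (Finset.univ.val.map l)).coeff j) (S : Finset (Fin n))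
    (hS : S.card = n - k + 1) : 0 < ∑ i ∈ S, l i := by
  have hc : (Sᶜ).card = k - 1 := by rw [Finset.card_compl, hS, Fintype.card_fin]; omega
  have e : Finset.univ.val.map l = (Sᶜ).val.map l + S.val.map l := by
    rw [← Multiset.map_add]; congr 1
    rw [← Finset.union_compl S, ← Finset.disjUnion_eq_union S Sᶜ disjoint_compl_right, add_comm]
    rfl
  have := remove_many ((Sᶜ).val.map l) (S.val.map l) 1 (by
    rw [← e]; intro j hj; apply h; simp [hc] at hj; omega) 1 le_rfl
  rw [R_one] at this
  exact this

lemma weighted {n m : ℕ} (l p : Fin n → ℝ) (hm : 1 ≤ m) (hmn : m ≤ n)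
    (h : ∀ S : Finset (Fin n), S.card = m → 0 < ∑ i ∈ S, l i)
    (p0 : ∀ i, 0 ≤ p i) (p1 : ∀ i, p i ≤ 1) (hp : ∑ i, p i = m) : 0 ≤ ∑ i, p i * l i := by
  obtain ⟨S, hS, hmin⟩ := Finset.exists_min_image
    (Finset.powersetCard m (Finset.univ : Finset (Fin n))) (fun S => ∑ i ∈ S, l i)
    (Finset.powersetCard_nonempty.2 (by simpa using hmn))
  have hSc := (Finset.mem_powersetCard.1 hS).2
  obtain ⟨a, ha, hmax⟩ := Finset.exists_max_image S l (Finset.card_pos.1 (by omega))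
  have hout : ∀ j ∉ S, l a ≤ l j := by
    intro j hj
    have hj' : j ∉ S.erase a := fun h => hj (Finset.mem_of_mem_erase h)
    have := hmin (insert j (S.erase a)) (by
      rw [Finset.mem_powersetCard]
      refine ⟨Finset.subset_univ _, ?_⟩
      rw [Finset.card_insert_of_notMem hj', Finset.card_erase_of_mem ha]; omega)
    rw [Finset.sum_insert hj', ← Finset.add_sum_erase S l ha] at this
    linarith
  have h1 : ∑ i, (if i ∈ S then l i - l a else 0) ≤ ∑ i, p i * (l i - l a) := by
    apply Finset.sum_le_sum
    intro i _
    split_ifs with hi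
    · nlinarith [hmax i hi, p1 i]
    · exact mul_nonneg (p0 i) (by linarith [hout i hi])
  have h2 : ∑ i, p i * (l i - l a) = ∑ i, p i * l i - m * l a := by
    simp_rw [mul_sub]; rw [Finset.sum_sub_distrib, ← Finset.sum_mul, hp]
  have h3 : ∑ i, (if i ∈ S then l i - l a else 0) = ∑ i ∈ S, l i - m * l a := by
    rw [← Finset.sum_filter]; simp [Finset.sum_sub_distrib, hSc]
  have := h S hSc
  linarith

end Stmt15

namespace Stmt15
open Polynomial Topology

lemma R_nonneg (s : Multiset ℝ) (h : ∀ a ∈ s, 0 ≤ a) (j : ℕ) : 0 ≤ (R s).coeff j := by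
  induction s using Multiset.induction generalizing j with
  | empty => simp only [R, Multiset.map_zero, Multiset.prod_zero, coeff_one]; split_ifs <;> norm_num
  | cons a s ih =>
    have ih := ih fun b hb => h b (Multiset.mem_cons_of_mem hb)
    cases j with
    | zero => rw [R_zero]; norm_num
    | succ j =>
      rw [R_cons_succ]
      exact add_nonneg (ih _) (mul_nonneg (h a (Multiset.mem_cons_self a s)) (ih _))

lemma R_pos (s : Multiset ℝ) (h : ∀ a ∈ s, 0 ≤ a) (j : ℕ) (hj : j ≤ s.countP (fun a => 0 < a)) :
    0 < (R s).coeff j := by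
  induction s using Multiset.induction generalizing j with
  | empty => simp at hj; subst hj; simp [R]
  | cons a s ih =>
    have h' : ∀ a ∈ s, 0 ≤ a := fun b hb => h b (Multiset.mem_cons_of_mem hb)
    have ha := h a (Multiset.mem_cons_self a s)
    cases j with
    | zero => rw [R_zero]; norm_num
    | succ j =>
      rw [R_cons_succ]
      by_cases h0 : 0 < a
      · rw [Multiset.countP_cons_of_pos (p := fun a : ℝ => 0 < a) s h0] at hj
        have := ih h' j (by omega)
        have := R_nonneg s h' (j + 1)
        positivity
      · rw [Multiset.countP_cons_of_neg (p := fun a : ℝ => 0 < a) s h0] at hj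
        have := ih h' (j + 1) hj
        have := R_nonneg s h' j
        positivity

lemma R_proj (s : Multiset ℝ) (h : ∀ a ∈ s, a = 0 ∨ a = 1) :
    R s = (1 + X) ^ (s.countP (fun a => 0 < a)) := by
  induction s using Multiset.induction with
  | empty => simp [R]
  | cons a s ih =>
    rw [R_cons, ih fun b hb => h b (Multiset.mem_cons_of_mem hb)]
    rcases h a (Multiset.mem_cons_self a s) with rfl | rfl
    · simp
    · rw [Multiset.countP_cons_of_pos (p := fun a : ℝ => 0 < a) s one_pos]; simp; ring

lemma coeff_of_eval {n : ℕ} (a : ℕ → ℝ) (p : ℝ[X])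
    (h : ∀ t, p.eval t = ∑ j ∈ Finset.range (n + 1), a j * t ^ j) (j : ℕ) (hj : j ≤ n) :
    a j = p.coeff j := by
  have : p = ∑ j ∈ Finset.range (n + 1), C (a j) * X ^ j := by
    apply Polynomial.funext; intro t; rw [h, eval_finsetSum]; simp
  rw [this, finsetSum_coeff]
  simp only [coeff_C_mul_X_pow]
  rw [Finset.sum_ite_eq, if_pos (by simp; omega)]

variable {n : ℕ}

lemma spectral (A : Matrix (Fin n) (Fin n) ℝ) (hA : A.IsSymm) :
    ∃ (U : Matrix (Fin n) (Fin n) ℝ) (l : Fin n → ℝ), U * Uᵀ = 1 ∧ Uᵀ * U = 1 ∧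
      A = U * diagonal l * Uᵀ := by
  have hH : A.IsHermitian := by
    rw [Matrix.IsHermitian, conjTranspose_eq_transpose_of_trivial]; exact hA
  refine ⟨hH.eigenvectorUnitary, hH.eigenvalues, ?_, ?_, ?_⟩
  · have := Unitary.coe_mul_star_self hH.eigenvectorUnitary
    rwa [Unitary.coe_star, star_eq_conjTranspose, conjTranspose_eq_transpose_of_trivial] at this
  · have := Unitary.coe_star_mul_self hH.eigenvectorUnitary
    rwa [star_eq_conjTranspose, conjTranspose_eq_transpose_of_trivial] at this
  · have := hH.spectral_theorem
    rw [Unitary.conjStarAlgAut_apply, star_eq_conjTranspose,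
      conjTranspose_eq_transpose_of_trivial] at this
    exact this

lemma det_diag (U : Matrix (Fin n) (Fin n) ℝ) (l : Fin n → ℝ) (h1 : U * Uᵀ = 1) (t : ℝ) :
    (1 + t • (U * diagonal l * Uᵀ)).det = (R (Finset.univ.val.map l)).eval t := by
  have e : 1 + t • (U * diagonal l * Uᵀ) = U * (diagonal fun i => 1 + t * l i) * Uᵀ := by
    have : (diagonal fun i => 1 + t * l i) = 1 + t • diagonal l := by
      ext i j; by_cases h : i = j
      · subst h; simp
      · simp [h]
    rw [this, mul_add, add_mul, mul_one, h1]; simp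
  rw [e, det_mul, det_mul, mul_right_comm, ← det_mul, h1, det_one, one_mul, det_diagonal, R,
    Multiset.map_map]
  change _ = eval t (∏ i, (1 + C (l i) * X))
  rw [eval_prod]
  refine Finset.prod_congr rfl fun i _ => ?_
  simp only [eval_add, eval_one, eval_mul, eval_C, eval_X]; ring

lemma sigma_diag {σ : Matrix (Fin n) (Fin n) ℝ → ℕ → ℝ}
    (hσ : ∀ (A : Matrix (Fin n) (Fin n) ℝ) (t : ℝ),
        (1 + t • A).det = ∑ j ∈ Finset.range (n + 1), σ A j * t ^ j)
    (U : Matrix (Fin n) (Fin n) ℝ) (l : Fin n → ℝ) (h1 : U * Uᵀ = 1) (j : ℕ)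
    (hj : j ≤ n) : σ (U * diagonal l * Uᵀ) j = (R (Finset.univ.val.map l)).coeff j :=
  coeff_of_eval _ _ (fun t => by rw [← hσ, det_diag U l h1]) j hj

lemma sigma_cont {σ : Matrix (Fin n) (Fin n) ℝ → ℕ → ℝ}
    (hσ : ∀ (A : Matrix (Fin n) (Fin n) ℝ) (t : ℝ),
        (1 + t • A).det = ∑ j ∈ Finset.range (n + 1), σ A j * t ^ j)
    (j : ℕ) (hj : j ≤ n) : Continuous fun A => σ A j := by
  let V : Matrix (Fin (n + 1)) (Fin (n + 1)) ℝ := vandermonde fun i => ((i : ℕ) : ℝ)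
  have hV : IsUnit V.det := by
    rw [isUnit_iff_ne_zero]
    apply det_vandermonde_ne_zero_iff.2
    intro a b h
    have h : ((a : ℕ) : ℝ) = ((b : ℕ) : ℝ) := h
    exact Fin.ext (by exact_mod_cast h)
  have key : ∀ A, (fun i : Fin (n + 1) => σ A i)
      = V⁻¹ *ᵥ (fun i : Fin (n + 1) => (1 + ((i : ℕ) : ℝ) • A).det) := by
    intro A
    have : (fun i : Fin (n + 1) => (1 + ((i : ℕ) : ℝ) • A).det)
        = V *ᵥ (fun i : Fin (n + 1) => σ A i) := by
      ext i
      rw [hσ, Finset.sum_range]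
      simp [V, mulVec, dotProduct, vandermonde_apply, mul_comm]
    rw [this, mulVec_mulVec, nonsing_inv_mul _ hV, one_mulVec]
  have : (fun A => σ A j) = fun A => (V⁻¹ *ᵥ (fun i : Fin (n + 1) =>
      (1 + ((i : ℕ) : ℝ) • A).det)) ⟨j, by omega⟩ := by
    funext A; rw [← key]
  rw [this]
  simp only [mulVec, dotProduct]
  refine continuous_finsetSum _ fun i _ => continuous_const.mul ?_
  apply Continuous.matrix_det
  fun_prop

/-- spectral data of a projection -/
lemma proj_data (Q : Matrix (Fin n) (Fin n) ℝ) (hs : Q.IsSymm) (hQ : Q * Q = Q) :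
    ∃ (U : Matrix (Fin n) (Fin n) ℝ) (l : Fin n → ℝ), U * Uᵀ = 1 ∧ Uᵀ * U = 1 ∧
      Q = U * diagonal l * Uᵀ ∧ (∀ i, l i = 0 ∨ l i = 1) ∧
      (Finset.univ.val.map l).countP (fun a => 0 < a) = Q.rank := by
  obtain ⟨U, l, h1, h2, h3⟩ := spectral Q hs
  have hD : diagonal l = Uᵀ * Q * U := by
    rw [h3]
    calc diagonal l = (Uᵀ * U) * diagonal l * (Uᵀ * U) := by rw [h2]; simp
      _ = _ := by simp only [Matrix.mul_assoc]
  have hDD : diagonal l * diagonal l = diagonal l := by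
    rw [hD]
    calc Uᵀ * Q * U * (Uᵀ * Q * U) = Uᵀ * Q * (U * Uᵀ) * Q * U := by
          simp only [Matrix.mul_assoc]
      _ = Uᵀ * (Q * Q) * U := by rw [h1]; simp [Matrix.mul_assoc]
      _ = _ := by rw [hQ]
  have h01 : ∀ i, l i = 0 ∨ l i = 1 := by
    intro i
    rw [diagonal_mul_diagonal] at hDD
    have := congrFun (diagonal_injective hDD) i
    have : l i * (l i - 1) = 0 := by linarith
    rcases mul_eq_zero.1 this with h | h
    · exact Or.inl h
    · exact Or.inr (by linarith)
  refine ⟨U, l, h1, h2, h3, h01, ?_⟩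
  have hu1 : IsUnit U.det := by
    apply IsUnit.of_mul_eq_one (Uᵀ.det); rw [← det_mul, h1, det_one]
  have hu2 : IsUnit (Uᵀ).det := by rwa [det_transpose]
  rw [h3, rank_mul_eq_left_of_isUnit_det _ _ hu2, rank_mul_eq_right_of_isUnit_det _ _ hu1,
    rank_diagonal, Multiset.countP_map, Fintype.card_subtype]
  change (Finset.univ.filter fun i => 0 < l i).card = _
  congr 1
  ext i
  rcases h01 i with h | h <;> simp [h]

end Stmt15

namespace Stmt15
open Polynomial Topology
variable {n : ℕ}

/-- `m` orthonormal vectors inside `W`, packaged as a matrix. -/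
lemma exists_frame (W : Submodule ℝ (Fin n → ℝ)) (m : ℕ) (hm : m ≤ Module.finrank ℝ W) :
    ∃ V : Matrix (Fin n) (Fin m) ℝ, Vᵀ * V = 1 ∧ ∀ j, (fun i => V i j) ∈ W := by
  let e := (WithLp.linearEquiv 2 ℝ (Fin n → ℝ)).symm
  let W' : Submodule ℝ (EuclideanSpace ℝ (Fin n)) := W.map e.toLinearMap
  have hW' : Module.finrank ℝ W' = Module.finrank ℝ W := LinearEquiv.finrank_map_eq e W
  let b := stdOrthonormalBasis ℝ W'
  let f : Fin m → Fin (Module.finrank ℝ W') := Fin.castLE (by omega)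
  refine ⟨Matrix.of fun i j => (b (f j) : EuclideanSpace ℝ (Fin n)) i, ?_, ?_⟩
  · ext i j
    have h := orthonormal_iff_ite.1 b.orthonormal (f i) (f j)
    rw [Submodule.coe_inner, PiLp.inner_apply] at h
    have hf : (f i = f j) ↔ i = j := (Fin.castLE_injective _).eq_iff
    simp only [hf] at h
    rw [Matrix.one_apply, ← h, Matrix.mul_apply]
    refine Finset.sum_congr rfl fun x _ => ?_
    exact mul_comm _ _
  · intro j
    obtain ⟨w, hw, he⟩ := (b (f j)).2
    have : (fun i => (b (f j) : EuclideanSpace ℝ (Fin n)) i) = w := by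
      rw [← he]; rfl
    change (fun i => (b (f j) : EuclideanSpace ℝ (Fin n)) i) ∈ W
    rw [this]; exact hw

/-- Trace against a rank `n-k+1` projection is nonnegative on the Garding cone. -/
lemma trace_nonneg (k : ℕ) (hk1 : 1 ≤ k) (hkn : k ≤ n)
    {σ : Matrix (Fin n) (Fin n) ℝ → ℕ → ℝ}
    (hσ : ∀ (A : Matrix (Fin n) (Fin n) ℝ) (t : ℝ),
        (1 + t • A).det = ∑ j ∈ Finset.range (n + 1), σ A j * t ^ j)
    (B : Matrix (Fin n) (Fin n) ℝ) (hB : B.IsSymm) (hG : ∀ j ≤ k, 0 < σ B j)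
    (A : Matrix (Fin n) (Fin n) ℝ) (hA : A.IsSymm) (hAA : A * A = A)
    (htr : A.trace = ((n - k + 1 : ℕ) : ℝ)) : 0 ≤ (A * B).trace := by
  obtain ⟨U, l, h1, h2, rfl⟩ := spectral B hB
  set M := Uᵀ * A * U with hM
  have hMs : Mᵀ = M := by
    rw [hM]; simp only [transpose_mul, transpose_transpose, hA.eq, Matrix.mul_assoc]
  have hMM : M * M = M := by
    calc Uᵀ * A * U * (Uᵀ * A * U) = Uᵀ * A * (U * Uᵀ) * A * U := by
          simp only [Matrix.mul_assoc]
      _ = Uᵀ * (A * A) * U := by rw [h1]; simp [Matrix.mul_assoc]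
      _ = _ := by rw [hAA]
  have hMt : M.trace = ((n - k + 1 : ℕ) : ℝ) := by
    rw [← htr, hM, Matrix.trace_mul_comm, ← Matrix.mul_assoc, h1, Matrix.one_mul]
  have hd : ∀ i, M i i ^ 2 ≤ M i i := by
    intro i
    have : M i i = ∑ j, M i j ^ 2 := by
      conv_lhs => rw [← hMM, Matrix.mul_apply]
      refine Finset.sum_congr rfl fun j _ => ?_
      have : M j i = M i j := by conv_lhs => rw [← hMs, transpose_apply]
      rw [this, sq]
    conv_rhs => rw [this]
    exact Finset.single_le_sum (f := fun j => M i j ^ 2) (fun j _ => sq_nonneg _)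
      (Finset.mem_univ i)
  have e : (A * (U * diagonal l * Uᵀ)).trace = ∑ i, M i i * l i := by
    calc (A * (U * diagonal l * Uᵀ)).trace = ((A * U * diagonal l) * Uᵀ).trace := by
          simp only [Matrix.mul_assoc]
      _ = (M * diagonal l).trace := by
          rw [Matrix.trace_mul_comm, hM]; simp only [Matrix.mul_assoc]
      _ = _ := by simp [Matrix.trace, mul_diagonal]
  rw [e]
  refine weighted l (fun i => M i i) (m := n - k + 1) (by omega) (by omega) ?_ ?_ ?_ hMt
  · intro S hS
    refine sum_pos_of_card l k hk1 hkn (fun j hj => ?_) S hS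
    rw [← sigma_diag hσ U l h1 j (by omega)]
    exact hG j hj
  · intro i; exact (sq_nonneg _).trans (hd i)
  · intro i; nlinarith [hd i]

end Stmt15

theorem stmt15 (n k : ℕ) (hk1 : 1 ≤ k) (hkn : k ≤ n)
    (σ : Matrix (Fin n) (Fin n) ℝ → ℕ → ℝ)
    (hσ : ∀ (A : Matrix (Fin n) (Fin n) ℝ) (t : ℝ),
        (1 + t • A).det = ∑ j ∈ Finset.range (n + 1), σ A j * t ^ j)
    (Pup : Set (Matrix (Fin n) (Fin n) ℝ))
    (hPup : Pup = closure (connectedComponentIn {A | A.IsSymm ∧ 0 < σ A k} 1))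
    (Plow : Set (Matrix (Fin n) (Fin n) ℝ))
    (hPlow : Plow = {A | A.IsSymm ∧ ∀ B ∈ Pup, 0 ≤ (A * B).trace}) :
    (∀ Q : Matrix (Fin n) (Fin n) ℝ, Q.IsSymm → Q * Q = Q → Q.rank = k →
        σ Q k = 1 ∧ Q ∈ intrinsicInterior ℝ Pup) ∧
    (∀ Q : Matrix (Fin n) (Fin n) ℝ, Q.IsSymm → Q * Q = Q → Q.rank = k - 1 →
        σ Q k = 0) ∧
    (∃ W : Submodule ℝ (Fin n → ℝ), Module.finrank ℝ W = n - k ∧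
        ∀ A ∈ Plow, (∀ x : Fin n → ℝ, (∀ w ∈ W, x ⬝ᵥ w = 0) → A.mulVec x = 0) → A = 0) ∧
    (∀ W : Submodule ℝ (Fin n → ℝ),
        (∀ A ∈ Plow, (∀ x : Fin n → ℝ, (∀ w ∈ W, x ⬝ᵥ w = 0) → A.mulVec x = 0) → A = 0) →
        Module.finrank ℝ W ≤ n - k) := by
  classical
  set E : Set (Matrix (Fin n) (Fin n) ℝ) := {A | A.IsSymm ∧ 0 < σ A k} with hE
  set K := connectedComponentIn E 1 with hK
  have hKE : K ⊆ E := connectedComponentIn_subset _ _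
  have hsymc : IsClosed {A : Matrix (Fin n) (Fin n) ℝ | A.IsSymm} :=
    isClosed_eq (by fun_prop) continuous_id
  have hKP : K ⊆ Pup := by rw [hPup]; exact subset_closure
  have hPs : ∀ A ∈ Pup, A.IsSymm := by
    intro A hA
    rw [hPup] at hA
    exact closure_minimal (fun B hB => (hKE hB).1) hsymc hA
  have hone : ∀ j ≤ n, 0 < σ 1 j := by
    intro j hj
    have h := Stmt15.sigma_diag hσ 1 (fun _ => 1) (by simp) j hj
    simp only [diagonal_one, Matrix.mul_one, Matrix.transpose_one] at h
    rw [h]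
    apply Stmt15.R_pos
    · intro a ha
      obtain ⟨i, -, rfl⟩ := Multiset.mem_map.1 ha
      norm_num
    · rw [Multiset.countP_map]; simpa using hj
  have h1E : (1 : Matrix (Fin n) (Fin n) ℝ) ∈ E := ⟨isSymm_one, hone k hkn⟩
  have h1K : (1 : Matrix (Fin n) (Fin n) ℝ) ∈ K := mem_connectedComponentIn h1E
  -- projections belong to the component
  have hproj : ∀ Q : Matrix (Fin n) (Fin n) ℝ, Q.IsSymm → Q * Q = Q → Q.rank = k → Q ∈ K := by
    intro Q hs hQ hr
    obtain ⟨U, l, u1, u2, hQe, h01, hc⟩ := Stmt15.proj_data Q hs hQ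
    have hseg : segment ℝ Q 1 ⊆ E := by
      rintro A ⟨a, b, ha, hb, hab, rfl⟩
      refine ⟨(hs.smul a).add (isSymm_one.smul b), ?_⟩
      have e : a • Q + b • (1 : Matrix (Fin n) (Fin n) ℝ)
          = U * diagonal (fun i => a * l i + b) * Uᵀ := by
        have : (diagonal fun i => a * l i + b) = a • diagonal l + b • 1 := by
          ext i j; by_cases h : i = j
          · subst h; simp
          · simp [h]
        rw [this, mul_add, add_mul, hQe]
        simp [u1]
      rw [e, Stmt15.sigma_diag hσ U _ u1 k hkn]
      apply Stmt15.R_pos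
      · intro x hx
        obtain ⟨i, -, rfl⟩ := Multiset.mem_map.1 hx
        rcases h01 i with h | h <;> simp only [h] <;> nlinarith
      · rw [← hr, ← hc, Multiset.countP_map, Multiset.countP_map]
        apply Multiset.card_le_card
        apply Multiset.monotone_filter_right
        intro i hi
        rcases h01 i with h | h
        · rw [h] at hi; exact absurd hi (lt_irrefl _)
        · rw [h]; linarith
    exact (convex_segment Q 1).isPreconnected.subset_connectedComponentIn
      (right_mem_segment ℝ Q 1) hseg (left_mem_segment ℝ Q 1)
  have hnb : ∀ Q ∈ K, ∃ S ∈ nhds Q, ∀ A ∈ S, A.IsSymm → A ∈ K := by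
    intro Q hQ
    have : LocallyConvexSpace ℝ (Matrix (Fin n) (Fin n) ℝ) :=
      inferInstanceAs (LocallyConvexSpace ℝ (Fin n → Fin n → ℝ))
    have ho : IsOpen {A : Matrix (Fin n) (Fin n) ℝ | 0 < σ A k} :=
      isOpen_lt continuous_const (Stmt15.sigma_cont hσ k hkn)
    obtain ⟨S, hS, hconv, hsub⟩ := (locallyConvexSpace_iff_exists_convex_subset ℝ _).1 this Q _
      (ho.mem_nhds (hKE hQ).2)
    refine ⟨S, hS, fun A hA hAs => ?_⟩
    have hc2 : Convex ℝ (S ∩ {A | A.IsSymm}) := by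
      apply hconv.inter
      intro x hx y hy a b _ _ _
      exact (Matrix.IsSymm.smul hx a).add (Matrix.IsSymm.smul hy b)
    have h3 := hc2.isPreconnected.subset_connectedComponentIn (F := E)
      ⟨mem_of_mem_nhds hS, (hKE hQ).1⟩ (fun B hB => ⟨hB.2, hsub hB.1⟩)
    rw [hK, connectedComponentIn_eq hQ]
    exact h3 ⟨hA, hAs⟩
  -- the component lies in the Garding cone
  have hG : ∀ A ∈ K, ∀ j ≤ k, 0 < σ A j := by
    have ho : IsOpen {A : Matrix (Fin n) (Fin n) ℝ | ∀ j ∈ Finset.range (k + 1), 0 < σ A j} := by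
      have : {A : Matrix (Fin n) (Fin n) ℝ | ∀ j ∈ Finset.range (k + 1), 0 < σ A j}
          = ⋂ j ∈ Finset.range (k + 1), {A | 0 < σ A j} := by ext; simp
      rw [this]
      apply isOpen_biInter_finset
      intro j hj
      rw [Finset.mem_range] at hj
      exact isOpen_lt continuous_const (Stmt15.sigma_cont hσ j (by omega))
    have hsub := (isPreconnected_connectedComponentIn (F := E) (x := 1)).subset_of_closure_inter_subset
      ho ⟨1, h1K, fun j hj => hone j (by rw [Finset.mem_range] at hj; omega)⟩ (by
        rintro A ⟨hAc, hAK⟩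
        have hnn : ∀ j ≤ k, 0 ≤ σ A j := by
          intro j hj
          have hcl : IsClosed {A | 0 ≤ σ A j} :=
            isClosed_le continuous_const (Stmt15.sigma_cont hσ j (by omega))
          exact closure_minimal (fun B hB => (hB j (by simp; omega)).le) hcl hAc
        obtain ⟨hAs, hAk⟩ := hKE hAK
        obtain ⟨U, l, u1, u2, rfl⟩ := Stmt15.spectral A hAs
        have hh : ∀ j ≤ k, σ (U * diagonal l * Uᵀ) j
            = (Stmt15.R (Finset.univ.val.map l)).coeff j :=
          fun j hj => Stmt15.sigma_diag hσ U l u1 j (by omega)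
        intro j hj
        have hj : j ≤ k := by rw [Finset.mem_range] at hj; omega
        rw [hh j hj]
        exact Stmt15.pos_of_nonneg _ k (fun j hj => hh j hj ▸ hnn j hj) (hh k le_rfl ▸ hAk) j hj)
    intro A hA j hj
    exact hsub hA j (by simp; omega)
  refine ⟨?_, ?_, ?_, ?_⟩
  · intro Q hs hQ hr
    constructor
    · obtain ⟨U, l, u1, u2, hQe, h01, hc⟩ := Stmt15.proj_data Q hs hQ
      rw [hr] at hc
      rw [hQe, Stmt15.sigma_diag hσ U l u1 k hkn, Stmt15.R_proj, hc, Polynomial.coeff_one_add_X_pow]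
      · simp
      · intro a ha
        obtain ⟨i, -, rfl⟩ := Multiset.mem_map.1 ha
        exact h01 i
    · have hQK := hproj Q hs hQ hr
      obtain ⟨S, hS, hSK⟩ := hnb Q hQK
      rw [mem_intrinsicInterior]
      refine ⟨⟨Q, subset_affineSpan ℝ _ (hKP hQK)⟩, ?_, rfl⟩
      rw [mem_interior_iff_mem_nhds]
      have hpre : (Subtype.val : affineSpan ℝ Pup → _) ⁻¹' S ∈
          nhds (⟨Q, subset_affineSpan ℝ _ (hKP hQK)⟩ : affineSpan ℝ Pup) :=
        continuous_subtype_val.continuousAt hS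
      refine Filter.mem_of_superset hpre ?_
      rintro ⟨A, hA⟩ hAS
      refine hKP (hSK A hAS ?_)
      let T : Submodule ℝ (Matrix (Fin n) (Fin n) ℝ) :=
        { carrier := {A | A.IsSymm}
          add_mem' := fun hx hy => Matrix.IsSymm.add hx hy
          zero_mem' := isSymm_zero
          smul_mem' := fun c _ hx => Matrix.IsSymm.smul hx c }
      have : affineSpan ℝ Pup ≤ T.toAffineSubspace := affineSpan_le.2 fun B hB => hPs B hB
      exact this hA
  · intro Q hs hQ hr
    obtain ⟨U, l, u1, u2, hQe, h01, hc⟩ := Stmt15.proj_data Q hs hQ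
    rw [hr] at hc
    rw [hQe, Stmt15.sigma_diag hσ U l u1 k hkn, Stmt15.R_proj, hc, Polynomial.coeff_one_add_X_pow]
    · rw [Nat.choose_eq_zero_of_lt (by omega)]; simp
    · intro a ha
      obtain ⟨i, -, rfl⟩ := Multiset.mem_map.1 ha
      exact h01 i
  · let q : Fin n → ℝ := fun i => if (i : ℕ) < k then 1 else 0
    set Q : Matrix (Fin n) (Fin n) ℝ := diagonal q with hQdef
    have hQs : Q.IsSymm := isSymm_diagonal q
    have hQQ : Q * Q = Q := by
      rw [hQdef, diagonal_mul_diagonal]; congr 1; ext i; simp [q]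
    have hQr : Q.rank = k := by
      rw [hQdef, rank_diagonal, Fintype.card_subtype]
      have : (Finset.univ.filter fun i : Fin n => q i ≠ 0)
          = Finset.univ.filter fun i : Fin n => (i : ℕ) < k := by
        ext i; simp [q]
      rw [this, Fin.card_filter_val_lt]; omega
    refine ⟨LinearMap.ker Q.mulVecLin, ?_, ?_⟩
    · have := LinearMap.finrank_range_add_finrank_ker Q.mulVecLin
      rw [Module.finrank_fin_fun] at this
      have h2 : Module.finrank ℝ (LinearMap.range Q.mulVecLin) = k := hQr
      omega
    · intro A hA hv
      rw [hPlow] at hA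
      obtain ⟨hAs, hAp⟩ := hA
      have hAQ : A * Q = 0 := by
        apply Matrix.mulVec_injective
        funext y
        rw [← mulVec_mulVec, zero_mulVec]
        apply hv
        intro w hw
        have hw : Q *ᵥ w = 0 := hw
        rw [← hQs.eq, mulVec_transpose, ← dotProduct_mulVec, hw, dotProduct_zero]
      obtain ⟨S, hS, hSK⟩ := hnb Q (hproj Q hQs hQQ hQr)
      have hcont : Continuous fun t : ℝ => Q - t • A := by fun_prop
      have hev : ∀ᶠ t : ℝ in nhds 0, Q - t • A ∈ S := by
        apply hcont.continuousAt.eventually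
        simpa using hS
      obtain ⟨t, htS, ht⟩ := ((hev.filter_mono nhdsWithin_le_nhds).and
        (self_mem_nhdsWithin : Set.Ioi (0:ℝ) ∈ nhdsWithin 0 (Set.Ioi 0))).exists
      have ht : 0 < t := ht
      have h1 := hAp _ (hKP (hSK _ htS (hQs.sub (hAs.smul t))))
      rw [mul_sub, hAQ, zero_sub, mul_smul_comm, trace_neg, trace_smul, smul_eq_mul] at h1
      have h2 : (A * A).trace ≤ 0 := by nlinarith
      have h3 : (A * A).trace = ∑ i, ∑ j, A i j ^ 2 := by
        simp only [Matrix.trace, Matrix.diag, Matrix.mul_apply]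
        refine Finset.sum_congr rfl fun i _ => Finset.sum_congr rfl fun j _ => ?_
        rw [hAs.apply, sq]
      rw [h3] at h2
      have hin : ∀ i ∈ Finset.univ, 0 ≤ ∑ j, A i j ^ 2 :=
        fun i _ => Finset.sum_nonneg fun j _ => sq_nonneg _
      have h4 := (Finset.sum_eq_zero_iff_of_nonneg hin).1
        (le_antisymm h2 (Finset.sum_nonneg hin))
      ext i j
      have h5 := (Finset.sum_eq_zero_iff_of_nonneg (fun j _ => sq_nonneg (A i j))).1
        (h4 i (Finset.mem_univ i)) j (Finset.mem_univ j)
      simpa using h5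
  · intro W hW
    by_contra hlt
    push Not at hlt
    obtain ⟨V, hVV, hVW⟩ := Stmt15.exists_frame W (n - k + 1) hlt
    have hAs : (V * Vᵀ).IsSymm := by rw [Matrix.IsSymm]; simp
    have htr : (V * Vᵀ).trace = ((n - k + 1 : ℕ) : ℝ) := by
      rw [Matrix.trace_mul_comm, hVV, trace_one, Fintype.card_fin]
    have hAA : V * Vᵀ * (V * Vᵀ) = V * Vᵀ := by
      calc V * Vᵀ * (V * Vᵀ) = V * (Vᵀ * V) * Vᵀ := by simp only [Matrix.mul_assoc]
        _ = _ := by rw [hVV, Matrix.mul_one]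
    have h0 := hW (V * Vᵀ) (by
      rw [hPlow]
      refine ⟨hAs, fun B hB => ?_⟩
      rw [hPup] at hB
      have hcl : IsClosed {B : Matrix (Fin n) (Fin n) ℝ | 0 ≤ (V * Vᵀ * B).trace} :=
        isClosed_le continuous_const (Continuous.matrix_trace (by fun_prop))
      exact closure_minimal (fun B hB => Stmt15.trace_nonneg k hk1 hkn hσ B (hKE hB).1 (hG B hB)
        (V * Vᵀ) hAs hAA htr) hcl hB) (by
      intro x hx
      rw [← mulVec_mulVec]
      have : Vᵀ *ᵥ x = 0 := by
        ext j
        have := hx _ (hVW j)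
        rw [dotProduct_comm] at this
        exact this
      rw [this, mulVec_zero])
    rw [h0, trace_zero] at htr
    have : (0 : ℝ) < ((n - k + 1 : ℕ) : ℝ) := by positivity
    linarith
end
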